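/- arXiv:2302.13158 — 4 statements merged into one kernel-verified Lean document; each statement's English description precedes it below -/
import Mathlib

section
/- Let U be an open subset of Euclidean space ℝⁿ, let l > 0, and let φ : ℝⁿ → ℝ be twice continuously differentiable on U with φ(x) > 0 for all x ∈ U. Suppose φ satisfies the screened Poisson equation l²·Δφ(x) = φ(x) for all x ∈ U. Then the log-transformed function w(x) = −l·log(φ(x)) satisfies the regularized Eikonal equation ‖∇w(x)‖² − l·Δw(x) = 1 for all x ∈ U. -/
open scoped RealInnerProductSpace

/-- If `φ > 0` is twice continuously differentiable on an open set `U ⊆ ℝⁿ`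
and satisfies the screened Poisson equation `l² Δφ = φ` on `U` (with `l > 0`), then
`w = -l·log φ` satisfies the regularized Eikonal equation `‖∇w‖² - l·Δw = 1` on `U`. -/
theorem screenedPoisson_log_transform_regularized_eikonal
    {n : ℕ} (U : Set (EuclideanSpace ℝ (Fin n))) (hU : IsOpen U)
    (l : ℝ) (hl : 0 < l)
    (φ : EuclideanSpace ℝ (Fin n) → ℝ)
    (hφ : ContDiffOn ℝ 2 φ U)
    (hpos : ∀ x ∈ U, 0 < φ x)
    (hPDE : ∀ x ∈ U,
      l ^ 2 * ∑ i : Fin n, iteratedFDeriv ℝ 2 φ x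
        ![EuclideanSpace.single i (1 : ℝ), EuclideanSpace.single i (1 : ℝ)] = φ x) :
    ∀ x ∈ U,
      ‖gradient (fun y => -l * Real.log (φ y)) x‖ ^ 2
        - l * ∑ i : Fin n, iteratedFDeriv ℝ 2 (fun y => -l * Real.log (φ y)) x
            ![EuclideanSpace.single i (1 : ℝ), EuclideanSpace.single i (1 : ℝ)] = 1 := by
  intro x hx
  have hφx : φ x ≠ 0 := (hpos x hx).ne'
  have hd : ∀ y ∈ U, HasFDerivAt (fun y => -l * Real.log (φ y))
      ((-l) • ((φ y)⁻¹ • fderiv ℝ φ y)) y := by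
    intro y hy
    have h1 : DifferentiableAt ℝ φ y :=
      (hφ.contDiffAt (hU.mem_nhds hy)).differentiableAt (by norm_num)
    exact (h1.hasFDerivAt.log (hpos y hy).ne').const_mul (-l)
  have hev : fderiv ℝ (fun y => -l * Real.log (φ y)) =ᶠ[nhds x]
      fun y => (-l) • ((φ y)⁻¹ • fderiv ℝ φ y) := by
    filter_upwards [hU.mem_nhds hx] with y hy using (hd y hy).fderiv
  have hc := hφ.contDiffAt (hU.mem_nhds hx)
  have h1 : HasFDerivAt φ (fderiv ℝ φ x) x :=
    (hc.differentiableAt (by norm_num)).hasFDerivAt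
  have h2 : HasFDerivAt (fderiv ℝ φ) (fderiv ℝ (fderiv ℝ φ) x) x :=
    ((hc.fderiv_right (m := 1) (by norm_num)).differentiableAt (by norm_num)).hasFDerivAt
  have hinv : HasFDerivAt (fun y => (φ y)⁻¹) ((-(φ x ^ 2)⁻¹) • fderiv ℝ φ x) x :=
    (hasDerivAt_inv hφx).comp_hasFDerivAt x h1
  have h3 := ((hinv.smul h2).const_smul (-l)).fderiv
  have hg : ‖gradient (fun y => -l * Real.log (φ y)) x‖ ^ 2 =
      ∑ i : Fin n, (-l * ((φ x)⁻¹ * fderiv ℝ φ x (EuclideanSpace.single i (1 : ℝ)))) ^ 2 := by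
    rw [EuclideanSpace.norm_sq_eq]
    refine Finset.sum_congr rfl fun i _ => ?_
    have h4 : inner ℝ (gradient (fun y => -l * Real.log (φ y)) x)
        (EuclideanSpace.single i (1 : ℝ)) =
        fderiv ℝ (fun y => -l * Real.log (φ y)) x (EuclideanSpace.single i (1 : ℝ)) := by
      simp only [gradient, InnerProductSpace.toDual_symm_apply]
    rw [(hd x hx).fderiv] at h4
    rw [EuclideanSpace.inner_single_right] at h4
    simp at h4
    simp only [neg_mul]
    rw [h4, Real.norm_eq_abs, sq_abs]
  have hP := hPDE x hx
  rw [hg]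
  simp only [iteratedFDeriv_two_apply, Matrix.cons_val_zero, Matrix.cons_val_one] at hP ⊢
  rw [hev.fderiv_eq]
  have h5 : ∀ v, fderiv ℝ (fun y => (-l) • ((φ y)⁻¹ • fderiv ℝ φ y)) x v v =
      -l * ((φ x)⁻¹ * fderiv ℝ (fderiv ℝ φ) x v v - (φ x ^ 2)⁻¹ * (fderiv ℝ φ x v) ^ 2) := by
    intro v
    erw [h3]
    simp
    ring
  simp only [h5]
  rw [Finset.mul_sum, ← Finset.sum_sub_distrib]
  calc _ = ∑ i : Fin n, (φ x)⁻¹ * (l ^ 2 * fderiv ℝ (fderiv ℝ φ) x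
        (EuclideanSpace.single i (1 : ℝ)) (EuclideanSpace.single i (1 : ℝ))) := by
        refine Finset.sum_congr rfl fun i _ => ?_
        ring
    _ = 1 := by
        rw [← Finset.mul_sum, ← Finset.mul_sum, hP, inv_mul_cancel₀ hφx]
end

section
/- Let Ω be a bounded open subset of Euclidean space ℝⁿ, let c > 0, and let φ : ℝⁿ → ℝ be continuous on the closure of Ω, twice continuously differentiable on Ω, satisfy the screened Poisson equation c·Δφ(x) = φ(x) for all x ∈ Ω, and satisfy the essential boundary condition φ(x) = 1 for all x in the frontier of Ω. Then 0 ≤ φ(x) ≤ 1 for every x in the closure of Ω. -/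
theorem aux_one {g : ℝ → ℝ} {a : ℝ} (hg : ContinuousAt g a) (h : IsLocalMax g a) :
    deriv (deriv g) a ≤ 0 := by
  by_contra! hpos
  have hmin := isLocalMin_of_deriv_deriv_pos hpos h.deriv_eq_zero hg
  have hc : g =ᶠ[nhds a] fun _ => g a := by
    filter_upwards [h, hmin] with y h1 h2
    exact le_antisymm h1 h2
  have h2 := hc.deriv.deriv_eq
  simp at h2
  linarith

theorem aux_two {E : Type*} [NormedAddCommGroup E] [NormedSpace ℝ E] {f : E → ℝ} {x : E}
    (hf : ContDiffAt ℝ 2 f x) (h : IsLocalMax f x) (v : E) :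
    iteratedFDeriv ℝ 2 f x ![v, v] ≤ 0 := by
  have hl : ∀ t : ℝ, HasDerivAt (fun t : ℝ => x + t • v) v t := fun t => by
    simpa using ((hasDerivAt_id t).smul_const v).const_add x
  have hlt : Filter.Tendsto (fun t : ℝ => x + t • v) (nhds 0) (nhds x) := by
    simpa using (hl 0).continuousAt.tendsto
  have hd : ∀ᶠ y in nhds x, DifferentiableAt ℝ f y := by
    filter_upwards [hf.eventually (by simp)] with y hy
    exact hy.differentiableAt (by simp)
  have e1 : deriv (fun t : ℝ => f (x + t • v)) =ᶠ[nhds 0]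
      fun t => fderiv ℝ f (x + t • v) v := by
    filter_upwards [hlt.eventually hd] with t ht
    exact (ht.hasFDerivAt.comp_hasDerivAt t (hl t)).deriv
  have hff : DifferentiableAt ℝ (fderiv ℝ f) x :=
    (hf.fderiv_right (m := 1) (by norm_num)).differentiableAt (by simp)
  have e2 : deriv (fun t : ℝ => fderiv ℝ f (x + t • v) v) 0 = fderiv ℝ (fderiv ℝ f) x v v := by
    have h0 : HasFDerivAt (fderiv ℝ f) (fderiv ℝ (fderiv ℝ f) x) (x + (0 : ℝ) • v) := by
      simpa using hff.hasFDerivAt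
    have h1 := h0.comp_hasDerivAt (0 : ℝ) (hl 0)
    have h2 := h1.clm_apply (hasDerivAt_const (0 : ℝ) v)
    simpa using h2.deriv
  have key := aux_one (g := fun t : ℝ => f (x + t • v)) (a := 0)
    (by
      have : ContinuousAt f (x + (0 : ℝ) • v) := by simpa using hf.continuousAt
      exact ContinuousAt.comp (f := fun t : ℝ => x + t • v) this (hl 0).continuousAt)
    (by
      filter_upwards [hlt.eventually h] with t ht
      simpa using ht)
  rw [e1.deriv_eq, e2] at key
  simpa [iteratedFDeriv_two_apply] using key

/-- Maximum principle for the screened Poisson equation: if `φ` is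
continuous on the closure of a bounded open set `Ω`, twice continuously differentiable
on `Ω`, satisfies `c·Δφ = φ` on `Ω` (with `c > 0`) and `φ = 1` on the frontier of `Ω`,
then `0 ≤ φ ≤ 1` on the closure of `Ω`. -/
theorem screenedPoisson_maximum_principle
    {n : ℕ} (Ω : Set (EuclideanSpace ℝ (Fin n))) (hΩo : IsOpen Ω)
    (hΩb : Bornology.IsBounded Ω)
    (c : ℝ) (hc : 0 < c)
    (φ : EuclideanSpace ℝ (Fin n) → ℝ)
    (hcont : ContinuousOn φ (closure Ω))
    (hφ : ContDiffOn ℝ 2 φ Ω)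
    (hPDE : ∀ x ∈ Ω,
      c * ∑ i : Fin n, iteratedFDeriv ℝ 2 φ x
        ![EuclideanSpace.single i (1 : ℝ), EuclideanSpace.single i (1 : ℝ)] = φ x)
    (hbc : ∀ x ∈ frontier Ω, φ x = 1) :
    ∀ x ∈ closure Ω, 0 ≤ φ x ∧ φ x ≤ 1 := by
  intro x hx
  have hK : IsCompact (closure Ω) := hΩb.isCompact_closure
  have hcase : ∀ y ∈ closure Ω, y ∈ Ω ∨ φ y = 1 := by
    intro y hy
    by_cases hyo : y ∈ Ω
    · exact Or.inl hyo
    · exact Or.inr (hbc y ⟨hy, by rwa [hΩo.interior_eq]⟩)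
  constructor
  · obtain ⟨m, hm, hmin⟩ := hK.exists_isMinOn ⟨x, hx⟩ hcont
    refine le_trans ?_ (hmin hx)
    rcases hcase m hm with hmo | h1
    · have hn := hΩo.mem_nhds hmo
      have hloc : IsLocalMax (fun y => -φ y) m :=
        (hmin.isLocalMin (Filter.mem_of_superset hn subset_closure)).neg
      have hC : ContDiffAt ℝ 2 φ m := hφ.contDiffAt hn
      rw [← hPDE m hmo]
      refine mul_nonneg hc.le (Finset.sum_nonneg fun i _ => ?_)
      have := aux_two hC.neg hloc (EuclideanSpace.single i (1 : ℝ))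
      have e : iteratedFDeriv ℝ 2 (fun y => -φ y) m = -iteratedFDeriv ℝ 2 φ m :=
        iteratedFDeriv_neg_apply
      rw [e] at this
      simpa using this
    · simp [h1]
  · obtain ⟨m, hm, hmax⟩ := hK.exists_isMaxOn ⟨x, hx⟩ hcont
    refine le_trans (hmax hx) ?_
    rcases hcase m hm with hmo | h1
    · have hn := hΩo.mem_nhds hmo
      have hloc : IsLocalMax φ m :=
        hmax.isLocalMax (Filter.mem_of_superset hn subset_closure)
      rw [← hPDE m hmo]
      refine le_trans (mul_nonpos_of_nonneg_of_nonpos hc.le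
        (Finset.sum_nonpos fun i _ => ?_)) zero_le_one
      exact aux_two (hφ.contDiffAt hn) hloc _
    · exact h1.le
end

section
/- Let Ω be a bounded open subset of Euclidean space ℝⁿ and let c > 0. If φ₁ and φ₂ are both continuous on the closure of Ω, twice continuously differentiable on Ω, satisfy the screened Poisson equation c·Δφᵢ(x) = φᵢ(x) for all x ∈ Ω, and agree on the frontier of Ω, then φ₁ = φ₂ on the closure of Ω (i.e. the solution of the screened Poisson boundary value problem is unique). -/
lemma aux_second {E : Type*} [NormedAddCommGroup E] [NormedSpace ℝ E] (g : E → ℝ) (x v : E)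
    (hg : ContDiffAt ℝ 2 g x) (hm : IsLocalMax g x) : iteratedFDeriv ℝ 2 g x ![v, v] ≤ 0 := by
  rw [iteratedFDeriv_two_apply]
  simp only [Matrix.cons_val_zero, Matrix.cons_val_one]
  by_contra! hpos
  have hline : ∀ t : ℝ, HasDerivAt (fun t : ℝ => x + t • v) v t := fun t => by
    simpa using ((hasDerivAt_id t).smul_const v).const_add x
  have htend : Filter.Tendsto (fun t : ℝ => x + t • v) (nhds 0) (nhds x) := by
    simpa using (hline 0).continuousAt.tendsto
  have hd : ∀ᶠ y in nhds x, DifferentiableAt ℝ g y :=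
    (hg.eventually (by simp)).mono fun y hy => hy.differentiableAt (by simp)
  have h1 : deriv (fun t : ℝ => g (x + t • v)) =ᶠ[nhds 0]
      fun t => fderiv ℝ g (x + t • v) v := by
    filter_upwards [htend.eventually hd] with t ht
    exact (ht.hasFDerivAt.comp_hasDerivAt t (hline t)).deriv
  have hdd : DifferentiableAt ℝ (fderiv ℝ g) x :=
    (hg.fderiv_right (m := 1) (by norm_num)).differentiableAt (by simp)
  have h2 : deriv (deriv (fun t : ℝ => g (x + t • v))) 0 = fderiv ℝ (fderiv ℝ g) x v v := by
    rw [h1.deriv_eq]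
    have h0 : x + (0 : ℝ) • v = x := by simp
    have hF : HasFDerivAt (fun y => fderiv ℝ g y v)
        ((ContinuousLinearMap.apply ℝ ℝ v).comp (fderiv ℝ (fderiv ℝ g) x)) (x + (0 : ℝ) • v) := by
      rw [h0]
      exact (ContinuousLinearMap.apply ℝ ℝ v).hasFDerivAt.comp x hdd.hasFDerivAt
    exact (hF.comp_hasDerivAt (0 : ℝ) (hline 0)).deriv
  have hmax : IsLocalMax (fun t : ℝ => g (x + t • v)) 0 := by
    have := htend.eventually hm
    simpa [IsLocalMax, IsMaxFilter] using this
  have hc : ContinuousAt (fun t : ℝ => g (x + t • v)) 0 := by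
    refine ContinuousAt.comp (g := g) (f := fun t : ℝ => x + t • v) ?_ (hline 0).continuousAt
    simpa using hg.continuousAt
  have hmin := isLocalMin_of_deriv_deriv_pos (by rw [h2]; exact hpos) hmax.deriv_eq_zero hc
  have hconst : (fun t : ℝ => g (x + t • v)) =ᶠ[nhds 0] fun _ => g (x + (0:ℝ) • v) := by
    filter_upwards [hmin, hmax] with t ha hb
    exact le_antisymm hb ha
  have := hconst.deriv.deriv_eq
  rw [h2] at this
  simp at this
  linarith

lemma aux_le
    {n : ℕ} (Ω : Set (EuclideanSpace ℝ (Fin n))) (hΩo : IsOpen Ω)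
    (hΩb : Bornology.IsBounded Ω)
    (c : ℝ) (hc : 0 < c)
    (φ₁ φ₂ : EuclideanSpace ℝ (Fin n) → ℝ)
    (hcont₁ : ContinuousOn φ₁ (closure Ω)) (hcont₂ : ContinuousOn φ₂ (closure Ω))
    (hφ₁ : ContDiffOn ℝ 2 φ₁ Ω) (hφ₂ : ContDiffOn ℝ 2 φ₂ Ω)
    (hPDE₁ : ∀ x ∈ Ω,
      c * ∑ i : Fin n, iteratedFDeriv ℝ 2 φ₁ x
        ![EuclideanSpace.single i (1 : ℝ), EuclideanSpace.single i (1 : ℝ)] = φ₁ x)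
    (hPDE₂ : ∀ x ∈ Ω,
      c * ∑ i : Fin n, iteratedFDeriv ℝ 2 φ₂ x
        ![EuclideanSpace.single i (1 : ℝ), EuclideanSpace.single i (1 : ℝ)] = φ₂ x)
    (hbc : ∀ x ∈ frontier Ω, φ₁ x = φ₂ x) :
    ∀ x ∈ closure Ω, φ₁ x ≤ φ₂ x := by
  intro y hy
  obtain ⟨x, hx, hmax⟩ := hΩb.isCompact_closure.exists_isMaxOn ⟨y, hy⟩ (hcont₁.sub hcont₂)
  have hxy : φ₁ y - φ₂ y ≤ φ₁ x - φ₂ x := hmax hy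
  suffices φ₁ x - φ₂ x ≤ 0 by linarith
  by_cases hxΩ : x ∈ Ω
  · have hn : Ω ∈ nhds x := hΩo.mem_nhds hxΩ
    have c1 := hφ₁.contDiffAt hn
    have c2 := hφ₂.contDiffAt hn
    have hl : IsLocalMax (φ₁ - φ₂) x :=
      hmax.isLocalMax (Filter.mem_of_superset hn subset_closure)
    rw [← hPDE₁ x hxΩ, ← hPDE₂ x hxΩ, ← mul_sub, ← Finset.sum_sub_distrib]
    refine mul_nonpos_of_nonneg_of_nonpos hc.le (Finset.sum_nonpos fun i _ => ?_)
    have := aux_second (φ₁ - φ₂) x (EuclideanSpace.single i (1 : ℝ)) (c1.sub c2) hl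
    rw [iteratedFDeriv_sub_apply c1 c2] at this
    simpa using this
  · have : x ∈ frontier Ω := by
      rw [hΩo.frontier_eq]; exact ⟨hx, hxΩ⟩
    rw [hbc x this]; simp

/-- Uniqueness for the screened Poisson boundary value problem on a
bounded open set: two solutions agreeing on the frontier agree on the closure. -/
theorem screenedPoisson_uniqueness
    {n : ℕ} (Ω : Set (EuclideanSpace ℝ (Fin n))) (hΩo : IsOpen Ω)
    (hΩb : Bornology.IsBounded Ω)
    (c : ℝ) (hc : 0 < c)
    (φ₁ φ₂ : EuclideanSpace ℝ (Fin n) → ℝ)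
    (hcont₁ : ContinuousOn φ₁ (closure Ω)) (hcont₂ : ContinuousOn φ₂ (closure Ω))
    (hφ₁ : ContDiffOn ℝ 2 φ₁ Ω) (hφ₂ : ContDiffOn ℝ 2 φ₂ Ω)
    (hPDE₁ : ∀ x ∈ Ω,
      c * ∑ i : Fin n, iteratedFDeriv ℝ 2 φ₁ x
        ![EuclideanSpace.single i (1 : ℝ), EuclideanSpace.single i (1 : ℝ)] = φ₁ x)
    (hPDE₂ : ∀ x ∈ Ω,
      c * ∑ i : Fin n, iteratedFDeriv ℝ 2 φ₂ x
        ![EuclideanSpace.single i (1 : ℝ), EuclideanSpace.single i (1 : ℝ)] = φ₂ x)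
    (hbc : ∀ x ∈ frontier Ω, φ₁ x = φ₂ x) :
    ∀ x ∈ closure Ω, φ₁ x = φ₂ x := by
  intro x hx
  exact le_antisymm
    (aux_le Ω hΩo hΩb c hc φ₁ φ₂ hcont₁ hcont₂ hφ₁ hφ₂ hPDE₁ hPDE₂ hbc x hx)
    (aux_le Ω hΩo hΩb c hc φ₂ φ₁ hcont₂ hcont₁ hφ₂ hφ₁ hPDE₂ hPDE₁ (fun z hz => (hbc z hz).symm) x hx)
end

section
/- Let a > 0 and x ∈ [−a, a]. Then the approximate distance function obtained from the one-dimensional screened Poisson solution converges to the exact distance to the boundary as the length parameter tends to zero: the function l ↦ −l·log( cosh(x/l)/cosh(a/l) ) tends to a − |x| as l → 0⁺ (within the filter of positive reals), where a − |x| is the distance from x to the boundary set {−a, a} of the interval. -/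
lemma adf_aux (y : ℝ) : Filter.Tendsto (fun l : ℝ => l * Real.log (Real.cosh (y / l)))
    (nhdsWithin 0 (Set.Ioi 0)) (nhds |y|) := by
  have h1 : Filter.Tendsto (fun l : ℝ => |y| - l * Real.log 2)
      (nhdsWithin 0 (Set.Ioi 0)) (nhds |y|) := by
    have : Filter.Tendsto (fun l : ℝ => |y| - l * Real.log 2) (nhds 0)
        (nhds (|y| - 0 * Real.log 2)) := Continuous.tendsto (by fun_prop) 0
    rw [zero_mul, sub_zero] at this
    exact this.mono_left nhdsWithin_le_nhds
  have hlow : ∀ t : ℝ, |t| - Real.log 2 ≤ Real.log (Real.cosh t) := by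
    intro t
    rw [← Real.cosh_abs t, Real.le_log_iff_exp_le (Real.cosh_pos _), Real.exp_sub,
      Real.exp_log (by norm_num), Real.cosh_eq]
    have := Real.exp_pos (-|t|)
    linarith
  have hup : ∀ t : ℝ, Real.log (Real.cosh t) ≤ |t| := by
    intro t
    rw [← Real.cosh_abs t, Real.log_le_iff_le_exp (Real.cosh_pos _), Real.cosh_eq]
    have : Real.exp (-|t|) ≤ Real.exp |t| := Real.exp_le_exp.2 (by linarith [abs_nonneg t])
    linarith
  have hmul : ∀ l : ℝ, 0 < l → l * |y / l| = |y| := by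
    intro l hl
    rw [abs_div, abs_of_pos hl]
    field_simp
  refine tendsto_of_tendsto_of_tendsto_of_le_of_le' h1 tendsto_const_nhds ?_ ?_
  · filter_upwards [self_mem_nhdsWithin] with l hl
    have h := mul_le_mul_of_nonneg_left (hlow (y / l)) (le_of_lt hl)
    rw [mul_sub, hmul l hl] at h
    exact h
  · filter_upwards [self_mem_nhdsWithin] with l hl
    have h := mul_le_mul_of_nonneg_left (hup (y / l)) (le_of_lt hl)
    rw [hmul l hl] at h
    exact h

/-- The 1D approximate distance function `g_l(x) = −l·log(φ_l x)` with
`φ_l x = cosh(x/l)/cosh(a/l)` converges, as `l → 0⁺`, to the exact distance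
`a − |x|` from `x ∈ [−a, a]` to the boundary `{−a, a}`. -/
theorem adf_tendsto_distance_1d
    (a : ℝ) (ha : 0 < a) (x : ℝ) (hx : x ∈ Set.Icc (-a) a) :
    Filter.Tendsto
      (fun l : ℝ => -l * Real.log (Real.cosh (x / l) / Real.cosh (a / l)))
      (nhdsWithin 0 (Set.Ioi 0)) (nhds (a - |x|)) := by
  have h := (adf_aux a).sub (adf_aux x)
  rw [abs_of_pos ha] at h
  refine h.congr fun l => ?_
  rw [Real.log_div (Real.cosh_pos _).ne' (Real.cosh_pos _).ne']
  ring
end
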